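/- arXiv:2310.16905 — 4 statements merged into one kernel-verified Lean document; each statement's English description precedes it below -/
import Mathlib

section
/- Let G be a finite simple graph on a vertex set V, and let σ : V → V be a fixed-point-free involution (σ ∘ σ = id and σ(v) ≠ v for all v). Suppose every induced subgraph of G on m ≥ 3 vertices has at most 3m − 6 edges. Then there exists a function c : V → Fin 12 such that c(σ(v)) = c(v) for every v ∈ V, and c(v) ≠ c(w) whenever v and w are adjacent in G and w ≠ σ(v). -/
open Classical in
/-- Handshake lemma for the subgraph induced on a finite set of vertices. -/
theorem SimpleGraph.sum_card_filter_adj_eq {V : Type*} (G : SimpleGraph V) (s : Finset V) :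
    ∑ v ∈ s, (s.filter (G.Adj v)).card = 2 * (G.induce (↑s : Set V)).edgeSet.ncard := by
  have h := (G.induce (↑s : Set V)).sum_degrees_eq_twice_card_edges
  rw [← SimpleGraph.coe_edgeFinset, Set.ncard_coe_finset, ← h, ← Finset.sum_coe_sort]
  refine Finset.sum_congr rfl fun v _ => ?_
  rw [← SimpleGraph.card_neighborFinset_eq_degree]
  symm
  refine Finset.card_bij (fun w _ => (w : V)) ?_ ?_ ?_
  · intro w hw
    rw [SimpleGraph.mem_neighborFinset] at hw
    exact Finset.mem_filter.2 ⟨w.2, hw⟩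
  · intro a _ b _ hab
    exact Subtype.ext hab
  · intro b hb
    rw [Finset.mem_filter] at hb
    exact ⟨⟨b, hb.1⟩, by rw [SimpleGraph.mem_neighborFinset]; exact hb.2, rfl⟩

open Classical in
/-- Under the hereditary edge bound, every nonempty `σ`-closed set of vertices contains an orbit
sending out at most eleven edges within the set. -/
theorem exists_orbit_degree_le_eleven {V : Type*} (G : SimpleGraph V)
    (σ : V → V) (hinv : Function.Involutive σ)
    (hplanar : ∀ s : Finset V, 3 ≤ s.card →
      (G.induce (↑s : Set V)).edgeSet.ncard ≤ 3 * s.card - 6)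
    (s : Finset V) (hs : ∀ v ∈ s, σ v ∈ s) (hne : s.Nonempty) :
    ∃ v ∈ s, (s.filter (G.Adj v)).card + (s.filter (G.Adj (σ v))).card ≤ 11 := by
  by_contra! hcon
  obtain ⟨v, hv⟩ := hne
  have hv12 := hcon v hv
  have hcard : 3 ≤ s.card := by
    have h1 := Finset.card_filter_le s (G.Adj v)
    have h2 := Finset.card_filter_le s (G.Adj (σ v))
    omega
  have hsum := G.sum_card_filter_adj_eq s
  have hσ : ∑ v ∈ s, (s.filter (G.Adj (σ v))).card = ∑ v ∈ s, (s.filter (G.Adj v)).card :=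
    Finset.sum_nbij' σ σ hs hs (fun a _ => hinv a) (fun a _ => hinv a) fun _ _ => rfl
  have hlow := Finset.card_nsmul_le_sum s _ 12 fun u hu => hcon u hu
  rw [Finset.sum_add_distrib, hσ, hsum, smul_eq_mul] at hlow
  have hup := hplanar s hcard
  omega

open Classical in
/-- A `σ`-closed set of vertices can be 12-pair-coloured, by removing orbits of small degree. -/
theorem exists_pair_colouring_on {V : Type*} (G : SimpleGraph V)
    (σ : V → V) (hinv : Function.Involutive σ)
    (hplanar : ∀ s : Finset V, 3 ≤ s.card →
      (G.induce (↑s : Set V)).edgeSet.ncard ≤ 3 * s.card - 6)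
    (s : Finset V) (hs : ∀ v ∈ s, σ v ∈ s) :
    ∃ c : V → Fin 12, (∀ v, c (σ v) = c v) ∧
      ∀ v ∈ s, ∀ w ∈ s, G.Adj v w → w ≠ σ v → c v ≠ c w := by
  induction s using Finset.strongInduction with
  | H s ih =>
  rcases s.eq_empty_or_nonempty with rfl | hne
  · exact ⟨fun _ => 0, fun _ => rfl, by simp⟩
  obtain ⟨v, hv, hdeg⟩ := exists_orbit_degree_le_eleven G σ hinv hplanar s hs hne
  have hmem : ∀ u, σ u = v ∨ σ u = σ v ↔ u = v ∨ u = σ v := fun u => by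
    rw [hinv.injective.eq_iff, hinv.eq_iff, or_comm]
  obtain ⟨c, hcσ, hc⟩ := ih (s.filter fun u => ¬ (u = v ∨ u = σ v))
    (Finset.filter_ssubset.2 ⟨v, hv, by simp⟩) (fun u hu => by
      rw [Finset.mem_filter] at hu ⊢
      exact ⟨hs u hu.1, by rw [hmem]; exact hu.2⟩)
  obtain ⟨a, ha⟩ : ∃ a, a ∉ (s.filter (G.Adj v) ∪ s.filter (G.Adj (σ v))).image c := by
    by_contra! hall
    have h1 := Finset.card_le_card (fun a _ => hall a : (Finset.univ : Finset (Fin 12)) ⊆ _)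
    rw [Finset.card_univ, Fintype.card_fin] at h1
    have h2 := Finset.card_image_le (s := s.filter (G.Adj v) ∪ s.filter (G.Adj (σ v))) (f := c)
    have h3 := Finset.card_union_le (s.filter (G.Adj v)) (s.filter (G.Adj (σ v)))
    omega
  have hfree : ∀ u x, u = v ∨ u = σ v → x ∈ s → G.Adj u x → a ≠ c x := by
    rintro u x hu hx hux rfl
    refine ha (Finset.mem_image_of_mem c ?_)
    rw [Finset.mem_union, Finset.mem_filter, Finset.mem_filter]
    rcases hu with rfl | rfl
    · exact Or.inl ⟨hx, hux⟩
    · exact Or.inr ⟨hx, hux⟩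
  refine ⟨fun u => if u = v ∨ u = σ v then a else c u, fun u => ?_, ?_⟩
  · simp only [hmem, hcσ]
  · intro u hu w hw huw hne
    by_cases h1 : u = v ∨ u = σ v <;> by_cases h2 : w = v ∨ w = σ v
    · exfalso
      rcases h1 with rfl | rfl <;> rcases h2 with rfl | rfl
      · exact huw.ne rfl
      · exact hne rfl
      · exact hne (hinv _).symm
      · exact huw.ne rfl
    · simpa only [if_pos h1, if_neg h2] using hfree u w h1 hw huw
    · simpa only [if_neg h1, if_pos h2] using (hfree w u h2 hu huw.symm).symm
    · simpa only [if_neg h1, if_neg h2] using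
        hc u (Finset.mem_filter.2 ⟨hu, h1⟩) w (Finset.mem_filter.2 ⟨hw, h2⟩) huw hne

/-- Heawood. Every finite simple graph `G` with a fixed-point-free
involution `σ` satisfying the planarity edge bound (every induced subgraph on `m ≥ 3`
vertices has at most `3m − 6` edges) admits a 12-pair-colouring: a colouring
`c : V → Fin 12` constant on σ-orbits and separating adjacent vertices from
different orbits. -/
theorem twelve_pair_colourable {V : Type*} [Fintype V] (G : SimpleGraph V)
    (σ : V → V) (hinv : σ ∘ σ = id) (hfpf : ∀ v, σ v ≠ v)
    (hplanar : ∀ s : Finset V, 3 ≤ s.card →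
      (G.induce (↑s : Set V)).edgeSet.ncard ≤ 3 * s.card - 6) :
    ∃ c : V → Fin 12, (∀ v, c (σ v) = c v) ∧
      ∀ v w, G.Adj v w → w ≠ σ v → c v ≠ c w := by
  obtain ⟨c, hcσ, hc⟩ := exists_pair_colouring_on G σ (congrFun hinv) hplanar Finset.univ
    fun _ _ => Finset.mem_univ _
  exact ⟨c, hcσ, fun v w => hc v (Finset.mem_univ v) w (Finset.mem_univ w)⟩
end

section
/- There exist a finite simple graph G on a 24-element vertex set V and a fixed-point-free involution σ : V → V (σ ∘ σ = id and σ(v) ≠ v for all v) such that: (a) no vertex v is adjacent in G to σ(v); (b) every induced subgraph of G on m ≥ 3 vertices has at most 3m − 6 edges; and (c) the quotient graph Q on the set of σ-orbits {v, σ(v)}, in which two distinct orbits are adjacent if and only if some vertex of one is adjacent in G to some vertex of the other, is isomorphic to the complete graph K₁₂ on 12 vertices. -/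
/-- If every vertex has at most three smaller neighbours, then `m` vertices span at most
`0 + 1 + 2 + 3 + 3 + ⋯` edges (`m` terms). -/
theorem SimpleGraph.ncard_edges_within_le {V : Type*} [LinearOrder V] (G : SimpleGraph V)
    [DecidableRel G.Adj] (h : ∀ (v : V) (s : Finset V), (∀ u ∈ s, u < v ∧ G.Adj v u) → s.card ≤ 3)
    (s : Finset V) :
    {e ∈ G.edgeSet | ∀ x ∈ e, x ∈ s}.ncard ≤ ∑ i ∈ Finset.range s.card, min i 3 := by
  induction s using Finset.induction_on_max with
  | empty =>
    suffices {e ∈ G.edgeSet | ∀ x ∈ e, x ∈ (∅ : Finset V)} = ∅ by rw [this]; simp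
    ext e
    induction e with | _ x y
    exact iff_of_false (fun he => by simpa using he.2 x (Sym2.mem_mk_left x y)) id
  | insert a s ha ih =>
    have ha' : a ∉ s := fun h => lt_irrefl a (ha a h)
    have hfin : {e ∈ G.edgeSet | ∀ x ∈ e, x ∈ s}.Finite := by
      exact s.sym2.finite_toSet.subset fun e he => Finset.mem_coe.2 (Finset.mem_sym2_iff.2 he.2)
    have hsub : {e ∈ G.edgeSet | ∀ x ∈ e, x ∈ insert a s} ⊆
        {e ∈ G.edgeSet | ∀ x ∈ e, x ∈ s} ∪
          ((s.filter (G.Adj a)).image fun u => s(a, u) : Finset (Sym2 V)) := by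
      intro e
      induction e with | _ x y
      simp only [Set.mem_ofPred_eq, SimpleGraph.mem_edgeSet, Sym2.mem_iff, forall_eq_or_imp,
        forall_eq, Finset.mem_insert, Set.mem_union, Finset.coe_image, Set.mem_image,
        Finset.mem_coe, Finset.mem_filter]
      rintro ⟨hxy, rfl | hx, rfl | hy⟩
      · exact (G.irrefl hxy).elim
      · exact .inr ⟨y, ⟨hy, hxy⟩, rfl⟩
      · exact .inr ⟨x, ⟨hx, hxy.symm⟩, Sym2.eq_swap⟩
      · exact .inl ⟨hxy, hx, hy⟩
    have hnew : (s.filter (G.Adj a)).card ≤ min s.card 3 :=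
      le_min (Finset.card_filter_le _ _) <| h a _ fun u hu => by
        rw [Finset.mem_filter] at hu
        exact ⟨ha u hu.1, hu.2⟩
    rw [Finset.card_insert_of_notMem ha', Finset.sum_range_succ]
    calc _ ≤ _ := Set.ncard_le_ncard hsub (hfin.union (Finset.finite_toSet _))
      _ ≤ _ := Set.ncard_union_le _ _
      _ ≤ _ := by
        rw [Set.ncard_coe_finset]
        exact add_le_add ih (Finset.card_image_le.trans hnew)

theorem SimpleGraph.ncard_edgeSet_induce_le {V : Type*} [LinearOrder V] (G : SimpleGraph V)
    [DecidableRel G.Adj] (h : ∀ (v : V) (s : Finset V), (∀ u ∈ s, u < v ∧ G.Adj v u) → s.card ≤ 3)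
    (s : Finset V) (hs : 3 ≤ s.card) :
    (G.induce (↑s : Set V)).edgeSet.ncard ≤ 3 * s.card - 6 := by
  have hsum : ∀ m, 3 ≤ m → ∑ i ∈ Finset.range m, min i 3 = 3 * m - 6 := by
    intro m hm
    induction m, hm using Nat.le_induction with
    | base => rfl
    | succ k hk ih => rw [Finset.sum_range_succ, ih, min_eq_right hk]; omega
  rw [← hsum _ hs, ← Set.ncard_image_of_injective _ (Sym2.map.injective Subtype.val_injective)]
  refine le_trans (Set.ncard_le_ncard ?_ ?_) (G.ncard_edges_within_le h s)
  · rintro _ ⟨e, he, rfl⟩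
    induction e with | _ x y
    simpa using he
  · exact s.sym2.finite_toSet.subset fun e he => Finset.mem_coe.2 (Finset.mem_sym2_iff.2 he.2)

/-- Each vertex of the example is joined to these at most three smaller vertices. -/
def pireBack : Fin 24 → Finset (Fin 24) :=
  ![∅, {0}, {0, 1}, {0, 1, 2}, {1, 2, 3}, {2, 3, 4}, {3, 4, 5}, {4, 5, 6}, {5, 6, 7},
    {6, 7, 8}, {7, 8, 9}, {8, 9, 10},
    {6, 9, 10}, {5, 7, 9}, {7, 8, 11}, {8, 10, 11}, {0, 9, 11}, {0, 10, 11}, {1, 2, 10},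
    {0, 3, 11}, {0, 1, 4}, {2, 3, 5}, {1, 2, 4}, {0, 1, 6}]

/-- The graph of the example; its vertices `v` and `v + 12` form a pair. -/
def pireGraph : SimpleGraph (Fin 24) where
  Adj u v := u ∈ pireBack v ∨ v ∈ pireBack u
  symm := ⟨fun _ _ => Or.symm⟩
  loopless := ⟨by decide⟩

instance : DecidableRel pireGraph.Adj :=
  fun u v => inferInstanceAs (Decidable (u ∈ pireBack v ∨ v ∈ pireBack u))

theorem pireGraph_card_smaller_neighbors_le (v : Fin 24) (s : Finset (Fin 24))
    (hs : ∀ u ∈ s, u < v ∧ pireGraph.Adj v u) : s.card ≤ 3 := by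
  have hlt : ∀ w, ∀ u ∈ pireBack w, u < w := by decide
  have hcard : ∀ w, (pireBack w).card ≤ 3 := by decide
  refine (Finset.card_le_card fun u hu => ?_).trans (hcard v)
  obtain ⟨huv, h | h⟩ := hs u hu
  · exact (lt_asymm huv (hlt u v h)).elim
  · exact h

/-- The index of the pair containing a vertex. -/
def pirePair (v : Fin 24) : Fin 12 := ⟨v % 12, Nat.mod_lt _ (by norm_num)⟩

theorem pireGraph_pairs_adjacent (p q : Fin 12) (hpq : p ≠ q) :
    ∃ v w, pirePair v = p ∧ pirePair w = q ∧ pireGraph.Adj v w := by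
  have key : ∀ p q : Fin 12, p ≠ q →
      pireGraph.Adj (p.castLE (by norm_num)) (q.castLE (by norm_num)) ∨
      pireGraph.Adj (p.natAdd 12) (q.castLE (by norm_num)) ∨
      pireGraph.Adj (p.castLE (by norm_num)) (q.natAdd 12) := by decide
  have hlow : ∀ r : Fin 12, pirePair (r.castLE (by norm_num)) = r := by decide
  have hhigh : ∀ r : Fin 12, pirePair (r.natAdd 12) = r := by decide
  obtain h | h | h := key p q hpq
  · exact ⟨_, _, hlow p, hlow q, h⟩
  · exact ⟨_, _, hhigh p, hlow q, h⟩
  · exact ⟨_, _, hlow p, hhigh q, h⟩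


/-- Heawood's example, found by Kim Scott. There is a simple graph `G`
on 24 vertices with a fixed-point-free involution `σ` such that no vertex is adjacent to
its partner, every induced subgraph on `m ≥ 3` vertices has at most `3m − 6` edges, and
the quotient graph on the 12 σ-orbits is isomorphic to `K₁₂`. -/
theorem exists_pire_map_with_quotient_K12 :
    ∃ (G : SimpleGraph (Fin 24)) (σ : Fin 24 → Fin 24),
      σ ∘ σ = id ∧ (∀ v, σ v ≠ v) ∧
      (∀ v, ¬ G.Adj v (σ v)) ∧
      (∀ s : Finset (Fin 24), 3 ≤ s.card →
        (G.induce (↑s : Set (Fin 24))).edgeSet.ncard ≤ 3 * s.card - 6) ∧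
      ∃ (π : Fin 24 → Fin 12) (Q : SimpleGraph (Fin 12)),
        Function.Surjective π ∧
        (∀ v w : Fin 24, π v = π w ↔ (w = v ∨ w = σ v)) ∧
        (∀ p q : Fin 12, Q.Adj p q ↔ p ≠ q ∧ ∃ v w, π v = p ∧ π w = q ∧ G.Adj v w) ∧
        Nonempty (Q ≃g (⊤ : SimpleGraph (Fin 12))) := by
  refine ⟨pireGraph, (· + 12), by decide, by decide, by decide,
    pireGraph.ncard_edgeSet_induce_le pireGraph_card_smaller_neighbors_le,
    pirePair, ⊤, by decide, by decide, fun p q => ?_, ⟨.refl⟩⟩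
  rw [SimpleGraph.top_adj]
  exact ⟨fun h => ⟨h, pireGraph_pairs_adjacent p q h⟩, And.left⟩
end

section
/- There exist a finite simple graph G on a vertex set V and a fixed-point-free involution σ : V → V (σ ∘ σ = id and σ(v) ≠ v for all v) such that every induced subgraph of G on m ≥ 3 vertices has at most 3m − 6 edges, yet there is no function c : V → Fin 11 with c(σ(v)) = c(v) for all v and c(v) ≠ c(w) whenever v and w are adjacent in G with w ≠ σ(v). -/
open Finset in
/-- If every vertex of `G` has at most `k` neighbours that precede it, then `G` has at most
`∑ i < #s, min i k` edges with both ends in `s`. -/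
theorem SimpleGraph.ncard_edgeSet_inter_sym2_le {V : Type*} [LinearOrder V] (G : SimpleGraph V)
    (k : ℕ) (B : V → Finset V) (hB : ∀ v, #(B v) ≤ k)
    (hG : ∀ v w, G.Adj v w → w < v → w ∈ B v) (s : Finset V) :
    (G.edgeSet ∩ (s.sym2 : Set (Sym2 V))).ncard ≤ ∑ i ∈ range #s, min i k := by
  induction s using Finset.induction_on_max with
  | empty => simp
  | insert a s ha ih =>
    have ha' : a ∉ s := fun h => lt_irrefl _ (ha a h)
    have hsub : G.edgeSet ∩ ((insert a s).sym2 : Set (Sym2 V)) ⊆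
        (G.edgeSet ∩ (s.sym2 : Set (Sym2 V))) ∪ ((s ∩ B a).image fun w => s(a, w)) := by
      rintro ⟨x, y⟩ ⟨hxy, hs⟩
      change G.Adj x y at hxy
      have hs' : (x = a ∨ x ∈ s) ∧ (y = a ∨ y ∈ s) := by simpa using hs
      obtain ⟨rfl | hx, rfl | hy⟩ := hs'
      · exact (G.loopless.irrefl _ hxy).elim
      · right
        exact mem_coe.2 (mem_image.2 ⟨y, mem_inter.2 ⟨hy, hG _ _ hxy (ha y hy)⟩, rfl⟩)
      · right
        exact mem_coe.2 (mem_image.2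
          ⟨x, mem_inter.2 ⟨hx, hG _ _ hxy.symm (ha x hx)⟩, Sym2.eq_swap⟩)
      · left
        exact ⟨hxy, mem_coe.2 (mk_mem_sym2_iff.2 ⟨hx, hy⟩)⟩
    have hfin : ((G.edgeSet ∩ (s.sym2 : Set (Sym2 V))) ∪
        ((s ∩ B a).image fun w => s(a, w) : Finset (Sym2 V))).Finite :=
      (s.sym2.finite_toSet.subset Set.inter_subset_right).union (finite_toSet _)
    have hcard : #((s ∩ B a).image fun w => s(a, w)) ≤ min #s k :=
      card_image_le.trans
        (le_min (card_le_card inter_subset_left) ((card_le_card inter_subset_right).trans (hB a)))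
    rw [card_insert_of_notMem ha', sum_range_succ]
    refine (Set.ncard_le_ncard hsub hfin).trans ((Set.ncard_union_le _ _).trans ?_)
    rw [Set.ncard_coe_finset]
    exact add_le_add ih hcard

theorem SimpleGraph.ncard_edgeSet_induce_le_s6 {V : Type*} (G : SimpleGraph V) (s : Finset V) :
    (G.induce (s : Set V)).edgeSet.ncard ≤ (G.edgeSet ∩ (s.sym2 : Set (Sym2 V))).ncard := by
  refine Set.ncard_le_ncard_of_injOn (Sym2.map Subtype.val) ?_
    (Sym2.map.injective Subtype.val_injective).injOn
    (s.sym2.finite_toSet.subset Set.inter_subset_right)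
  rintro ⟨⟨x, hx⟩, ⟨y, hy⟩⟩ hxy
  exact ⟨hxy, Finset.mem_coe.2 (Finset.mk_mem_sym2_iff.2 ⟨hx, hy⟩)⟩

theorem sum_range_min_three {m : ℕ} (hm : 3 ≤ m) :
    ∑ i ∈ Finset.range m, min i 3 = 3 * m - 6 := by
  induction m, hm using Nat.le_induction with
  | base => decide
  | succ m hm ih => rw [Finset.sum_range_succ, ih]; omega

/-- The neighbours preceding each vertex in a graph on 24 vertices, no vertex having more than
three, in which any two of the twelve pairs `{v, 23 - v}` are joined by exactly one edge. The
vertices below 12 induce the cube of a path, and the others are adjacent only to those. -/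
def precedingNeighbors : Fin 24 → Finset (Fin 24) :=
  ![∅, {0}, {0, 1}, {0, 1, 2}, {1, 2, 3}, {2, 3, 4}, {3, 4, 5}, {4, 5, 6}, {5, 6, 7}, {6, 7, 8},
    {7, 8, 9}, {8, 9, 10},
    {0, 1, 4}, {0, 1, 2}, {0, 1, 5}, {0, 2, 3}, {1, 3, 11}, {2, 10, 11}, {0, 10, 11}, {8, 9, 10},
    {9, 10, 11}, {7, 9, 11}, {5, 6, 8}, {4, 6, 7}]

theorem card_precedingNeighbors_le (v : Fin 24) : (precedingNeighbors v).card ≤ 3 := by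
  revert v; decide

theorem lt_of_mem_precedingNeighbors {v w : Fin 24} (h : w ∈ precedingNeighbors v) : w < v := by
  revert v w; decide

theorem exists_mem_precedingNeighbors_of_lt {i j : Fin 12} (h : i < j) :
    ∃ v w : Fin 24, w ∈ precedingNeighbors v ∧
      ((v = i.castLE (by decide) ∨ v.rev = i.castLE (by decide)) ∧
          (w = j.castLE (by decide) ∨ w.rev = j.castLE (by decide)) ∨
        (v = j.castLE (by decide) ∨ v.rev = j.castLE (by decide)) ∧
          (w = i.castLE (by decide) ∨ w.rev = i.castLE (by decide))) := by
  revert i j; decide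


/-- There is a finite simple graph `G` with a fixed-point-free
involution `σ` satisfying the planarity edge bound (every induced subgraph on `m ≥ 3`
vertices has at most `3m − 6` edges) which admits no 11-pair-colouring. -/
theorem exists_pire_map_not_eleven_pair_colourable :
    ∃ (V : Type) (G : SimpleGraph V) (σ : V → V),
      Finite V ∧
      σ ∘ σ = id ∧ (∀ v, σ v ≠ v) ∧
      (∀ s : Finset V, 3 ≤ s.card →
        (G.induce (↑s : Set V)).edgeSet.ncard ≤ 3 * s.card - 6) ∧
      ¬ ∃ c : V → Fin 11, (∀ v, c (σ v) = c v) ∧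
          ∀ v w, G.Adj v w → w ≠ σ v → c v ≠ c w := by
  have hadj : ∀ v w, (SimpleGraph.fromRel fun v w => w ∈ precedingNeighbors v).Adj v w →
      w < v → w ∈ precedingNeighbors v := by
    intro v w h hwv
    obtain ⟨-, h | h⟩ := (SimpleGraph.fromRel_adj _ _ _).1 h
    · exact h
    · exact absurd (lt_of_mem_precedingNeighbors h) hwv.asymm
  refine ⟨Fin 24, SimpleGraph.fromRel fun v w => w ∈ precedingNeighbors v, Fin.rev,
    inferInstance, funext Fin.rev_rev, by decide, fun s hs => ?_, ?_⟩
  · refine (SimpleGraph.ncard_edgeSet_induce_le_s6 _ s).trans ?_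
    rw [← sum_range_min_three hs]
    exact SimpleGraph.ncard_edgeSet_inter_sym2_le _ 3 _ card_precedingNeighbors_le hadj s
  · rintro ⟨c, hσ, hc⟩
    let f : Fin 12 → Fin 11 := fun i => c (i.castLE (by decide))
    obtain ⟨i, j, hij, hf⟩ := Fintype.exists_ne_map_eq_of_card_lt f (by simp)
    wlog hlt : i < j generalizing i j
    · exact this j i hij.symm hf.symm (hij.symm.lt_of_le (not_lt.1 hlt))
    have hcol : ∀ {v : Fin 24} {l : Fin 12},
        (v = l.castLE (by decide) ∨ v.rev = l.castLE (by decide)) → c v = f l := by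
      rintro v l (h | h)
      · exact congrArg c h
      · exact (hσ v).symm.trans (congrArg c h)
    have hrev : ∀ v, v.rev ∉ precedingNeighbors v := by decide
    obtain ⟨v, w, hw, h⟩ := exists_mem_precedingNeighbors_of_lt hlt
    refine hc v w ((SimpleGraph.fromRel_adj _ _ _).2
      ⟨(lt_of_mem_precedingNeighbors hw).ne', Or.inl hw⟩) (fun h => hrev v (h ▸ hw)) ?_
    obtain ⟨hv, hw⟩ | ⟨hv, hw⟩ := h
    · rw [hcol hv, hcol hw, hf]
    · rw [hcol hv, hcol hw, hf]
end

section
/- The number 12 is the least natural number k with the following property: for every finite simple graph G on a vertex set V and every fixed-point-free involution σ : V → V (σ ∘ σ = id and σ(v) ≠ v for all v) such that every induced subgraph of G on m ≥ 3 vertices has at most 3m − 6 edges, there exists a function c : V → Fin k with c(σ(v)) = c(v) for all v and c(v) ≠ c(w) whenever v and w are adjacent in G with w ≠ σ(v). -/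
open Finset

namespace PairColouring

section UpperBound

open Classical in
/-- The degrees inside `s` sum to twice the number of edges induced by `s`. -/
theorem sum_card_filter_adj {V : Type*} (G : SimpleGraph V) (s : Finset V) :
    ∑ v ∈ s, #{w ∈ s | G.Adj v w} = 2 * (G.induce (↑s : Set V)).edgeSet.ncard := by
  rw [← SimpleGraph.coe_edgeFinset, Set.ncard_coe_finset,
    ← SimpleGraph.sum_degrees_eq_twice_card_edges, ← Finset.sum_coe_sort s]
  refine Finset.sum_congr rfl fun v _ => ?_
  rw [← SimpleGraph.card_neighborFinset_eq_degree]
  symm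
  refine Finset.card_bij (fun w _ => w.1) ?_ ?_ ?_
  · intro w hw
    have hw' : G.Adj v.1 w.1 := by simpa using hw
    exact Finset.mem_filter.2 ⟨w.2, hw'⟩
  · intro a _ b _ h
    exact Subtype.ext h
  · intro b hb
    obtain ⟨hb, hvb⟩ := Finset.mem_filter.1 hb
    exact ⟨⟨b, hb⟩, by simpa using hvb, rfl⟩

open Classical in
/-- Under the hereditary edge bound, a nonempty union of pairs contains a pair of total
degree less than `12`. -/
theorem exists_pair_card_lt {V : Type*} {G : SimpleGraph V} {σ : V → V}
    (hσ : Function.Involutive σ)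
    (hG : ∀ s : Finset V, 3 ≤ s.card →
      (G.induce (↑s : Set V)).edgeSet.ncard ≤ 3 * s.card - 6)
    {s : Finset V} (hs : ∀ v ∈ s, σ v ∈ s) (hne : s.Nonempty) :
    ∃ v ∈ s, #{w ∈ s | G.Adj v w} + #{w ∈ s | G.Adj (σ v) w} < 12 := by
  by_contra! h
  have hsum : ∑ v ∈ s, #{w ∈ s | G.Adj (σ v) w} = ∑ v ∈ s, #{w ∈ s | G.Adj v w} :=
    Finset.sum_nbij' σ σ hs hs (fun v _ => hσ v) (fun v _ => hσ v) (fun _ _ => rfl)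
  have htotal := Finset.card_nsmul_le_sum s _ 12 h
  rw [Finset.sum_add_distrib, hsum, sum_card_filter_adj, smul_eq_mul] at htotal
  have hpos := hne.card_pos
  by_cases hcard : 3 ≤ #s
  · have := hG s hcard
    omega
  · obtain ⟨v, hv⟩ := hne
    have h₁ := h v hv
    have h₂ := Finset.card_filter_le s (fun w => G.Adj v w)
    have h₃ := Finset.card_filter_le s (fun w => G.Adj (σ v) w)
    omega

open Classical in
/-- Heawood's bound on a union of pairs. -/
theorem exists_pair_colouring_on {V : Type*} {G : SimpleGraph V} {σ : V → V}
    (hσ : Function.Involutive σ)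
    (hG : ∀ s : Finset V, 3 ≤ s.card →
      (G.induce (↑s : Set V)).edgeSet.ncard ≤ 3 * s.card - 6)
    (s : Finset V) (hs : ∀ v ∈ s, σ v ∈ s) :
    ∃ c : V → Fin 12, (∀ v, c (σ v) = c v) ∧
      ∀ v ∈ s, ∀ w ∈ s, G.Adj v w → w ≠ σ v → c v ≠ c w := by
  induction s using Finset.strongInduction with
  | H s ih =>
  rcases s.eq_empty_or_nonempty with rfl | hne
  · exact ⟨fun _ => 0, by simp⟩
  obtain ⟨v, hv, hdeg⟩ := exists_pair_card_lt hσ hG hs hne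
  obtain ⟨c, hc, hproper⟩ := ih (s.filter fun w => w ≠ v ∧ w ≠ σ v)
    (Finset.filter_ssubset.2 ⟨v, hv, by simp⟩) (by
      intro w hw
      obtain ⟨hw, h₁, h₂⟩ := Finset.mem_filter.1 hw
      refine Finset.mem_filter.2 ⟨hs w hw, fun h => h₂ ?_, fun h => h₁ (hσ.injective h)⟩
      rw [← h, hσ w])
  obtain ⟨x, hx⟩ : ∃ x, x ∉ ({w ∈ s | G.Adj v w} ∪ {w ∈ s | G.Adj (σ v) w}).image c := by
    by_contra! h
    have h₁ := Finset.card_le_card (fun x _ => h x : (univ : Finset (Fin 12)) ⊆ _)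
    have h₂ := h₁.trans (Finset.card_image_le.trans (Finset.card_union_le _ _))
    rw [Finset.card_fin] at h₂
    omega
  have hfresh : ∀ u w, w ∈ s → (u = v ∨ u = σ v) → G.Adj u w → c w ≠ x := by
    rintro u w hw hu huw rfl
    refine hx (Finset.mem_image_of_mem c ?_)
    rcases hu with rfl | rfl <;> simp [hw, huw]
  have hpair : ∀ w, (σ w = v ∨ σ w = σ v) ↔ (w = v ∨ w = σ v) := by
    intro w
    rw [hσ.injective.eq_iff, hσ.eq_iff, or_comm]
  refine ⟨fun w => if w = v ∨ w = σ v then x else c w, fun w => ?_, ?_⟩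
  · simp only [hpair, hc]
  · intro u hu w hw huw hne
    by_cases h₁ : u = v ∨ u = σ v <;> by_cases h₂ : w = v ∨ w = σ v
    · exfalso
      have := huw.ne
      have := hσ v
      grind
    · simpa [h₁, h₂] using (hfresh u w hw h₁ huw).symm
    · simpa [h₁, h₂] using hfresh w u hu h₂ huw.symm
    · simp only [h₁, h₂, if_false]
      rw [not_or] at h₁ h₂
      exact hproper u (Finset.mem_filter.2 ⟨hu, h₁⟩) w (Finset.mem_filter.2 ⟨hw, h₂⟩) huw hne

end UpperBound

section Degenerate

open Classical in
/-- Adding a vertex to an induced subgraph adds its neighbours to the edge count. -/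
theorem ncard_edgeSet_induce_insert {V : Type*} [DecidableEq V] (G : SimpleGraph V)
    {a : V} {s : Finset V} (ha : a ∉ s) :
    (G.induce (↑(insert a s) : Set V)).edgeSet.ncard =
      (G.induce (↑s : Set V)).edgeSet.ncard + #{w ∈ s | G.Adj a w} := by
  have h := sum_card_filter_adj G (insert a s)
  have hdeg : ∀ v ∈ s, #{w ∈ insert a s | G.Adj v w} =
      #{w ∈ s | G.Adj v w} + if G.Adj a v then 1 else 0 := by
    intro v _
    by_cases hav : G.Adj a v
    · rw [Finset.filter_insert, if_pos hav.symm, if_pos hav, Finset.card_insert_of_notMem]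
      simp [ha]
    · rw [Finset.filter_insert, if_neg (fun h => hav h.symm), if_neg hav, add_zero]
  rw [Finset.sum_insert ha, Finset.filter_insert, if_neg (G.loopless.irrefl a),
    Finset.sum_congr rfl hdeg, Finset.sum_add_distrib, sum_card_filter_adj,
    ← Finset.card_filter] at h
  omega

open Classical in
/-- A graph on a linear order in which every vertex has at most three smaller neighbours
satisfies the hereditary edge bound of planar graphs. -/
theorem ncard_edgeSet_induce_le {V : Type*} [LinearOrder V] {G : SimpleGraph V}
    {b : V → Finset V} (hb : ∀ v, #(b v) ≤ 3) (hG : ∀ u v, G.Adj u v → u < v → u ∈ b v)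
    (s : Finset V) (hs : 3 ≤ #s) :
    (G.induce (↑s : Set V)).edgeSet.ncard ≤ 3 * #s - 6 := by
  suffices h : (#s < 3 → (G.induce (↑s : Set V)).edgeSet.ncard ≤ #s - 1) ∧
      (3 ≤ #s → (G.induce (↑s : Set V)).edgeSet.ncard ≤ 3 * #s - 6) from h.2 hs
  clear hs
  induction s using Finset.induction_on_max with
  | empty =>
    have h := sum_card_filter_adj G ∅
    rw [Finset.sum_empty] at h
    rw [Finset.card_empty]
    omega
  | insert a s ha ih =>
    have has : a ∉ s := fun h => (ha a h).false
    have h₁ : #{w ∈ s | G.Adj a w} ≤ 3 :=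
      (Finset.card_le_card fun w hw => by
        obtain ⟨hw, haw⟩ := Finset.mem_filter.1 hw
        exact hG w a haw.symm (ha w hw)).trans (hb a)
    have h₂ := Finset.card_filter_le s (fun w => G.Adj a w)
    rw [ncard_edgeSet_induce_insert G has, Finset.card_insert_of_notMem has]
    omega

end Degenerate

section Extremal

/-- The smaller neighbours in a `3`-degenerate graph on `24` vertices whose quotient by
`v ↦ v + 12` is complete. The first twelve vertices form the cube of a path. -/
def backNeighbours (v : Fin 24) : Finset (Fin 24) :=
  if v < 12 then univ.filter fun u => u < v ∧ v.val ≤ u.val + 3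
  else {Fin.ofNat 24 ((v.val + 4) % 12), Fin.ofNat 24 ((v.val + 5) % 12),
    ![10, 11, 11, 9, 10, 11, 0, 1, 2, 0, 1, 0] (Fin.ofNat 12 v.val)}

/-- The `3`-degenerate graph on `24` vertices with back neighbours `backNeighbours`. -/
def extremalGraph : SimpleGraph (Fin 24) :=
  SimpleGraph.fromRel fun u v => u ∈ backNeighbours v

theorem card_backNeighbours_le : ∀ v, #(backNeighbours v) ≤ 3 := by decide

theorem lt_of_mem_backNeighbours : ∀ v, ∀ u ∈ backNeighbours v, u < v := by decide

theorem mem_backNeighbours_of_adj {u v : Fin 24} (h : extremalGraph.Adj u v) (huv : u < v) :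
    u ∈ backNeighbours v := by
  rcases ((SimpleGraph.fromRel_adj _ _ _).1 h).2 with h | h
  · exact h
  · exact absurd (lt_of_mem_backNeighbours _ _ h) huv.not_gt

set_option maxRecDepth 100000 in
/-- Any two distinct pairs of `v ↦ v + 12` are joined by an edge. -/
theorem exists_back_edge_between_pairs : ∀ p q : Fin 24, p < 12 → q < 12 → p ≠ q →
    ∃ u ∈ [p, p + 12], ∃ v ∈ [q, q + 12],
      v ≠ u + 12 ∧ (u ∈ backNeighbours v ∨ v ∈ backNeighbours u) := by
  decide

/-- Every pair-colouring of `extremalGraph` with pairs `{v, v + 12}` uses at least twelve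
colours. -/
theorem twelve_le_of_pair_colouring {k : ℕ} {c : Fin 24 → Fin k} (hc : ∀ v, c (v + 12) = c v)
    (hproper : ∀ v w, extremalGraph.Adj v w → w ≠ v + 12 → c v ≠ c w) : 12 ≤ k := by
  have hinj : Function.Injective fun p : Fin 12 => c (Fin.castLE (by decide) p) := by
    intro p q hpq
    by_contra hne
    obtain ⟨u, hu, v, hv, hvu, huv⟩ := exists_back_edge_between_pairs
      (Fin.castLE (by decide) p) (Fin.castLE (by decide) q) p.2 q.2
      (fun h => hne (Fin.castLE_injective _ h))
    have hcu : c u = c (Fin.castLE (by decide) p) := by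
      rcases List.mem_pair.1 hu with rfl | rfl
      · rfl
      · exact hc _
    have hcv : c v = c (Fin.castLE (by decide) q) := by
      rcases List.mem_pair.1 hv with rfl | rfl
      · rfl
      · exact hc _
    have hne : u ≠ v := by
      rintro rfl
      exact (lt_of_mem_backNeighbours u u (or_self_iff.1 huv)).false
    exact hproper u v ((SimpleGraph.fromRel_adj _ _ _).2 ⟨hne, huv⟩) hvu
      (hcu.trans (hpq.trans hcv.symm))
  simpa using Fintype.card_le_of_injective _ hinj

end Extremal

end PairColouring

/-- `12` is the least `k` such that every finite simple graph with a
fixed-point-free involution satisfying the planarity edge bound (every induced subgraph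
on `m ≥ 3` vertices has at most `3m − 6` edges) admits a `k`-pair-colouring. -/
theorem twelve_is_least_pair_colouring_bound :
    IsLeast {k : ℕ |
      ∀ (V : Type) (G : SimpleGraph V) (σ : V → V),
        Finite V →
        σ ∘ σ = id →
        (∀ v, σ v ≠ v) →
        (∀ s : Finset V, 3 ≤ s.card →
          (G.induce (↑s : Set V)).edgeSet.ncard ≤ 3 * s.card - 6) →
        ∃ c : V → Fin k, (∀ v, c (σ v) = c v) ∧
          ∀ v w, G.Adj v w → w ≠ σ v → c v ≠ c w} 12 := by
  refine ⟨fun V G σ _ hσ _ hG => ?_, fun k hk => ?_⟩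
  · have := Fintype.ofFinite V
    obtain ⟨c, hc, hproper⟩ :=
      PairColouring.exists_pair_colouring_on (fun v => congrFun hσ v) hG Finset.univ (by simp)
    exact ⟨c, hc, fun v w => hproper v (Finset.mem_univ v) w (Finset.mem_univ w)⟩
  · obtain ⟨c, hc, hproper⟩ := hk (Fin 24) PairColouring.extremalGraph (fun v => v + 12)
      inferInstance (by decide) (by decide)
      (PairColouring.ncard_edgeSet_induce_le PairColouring.card_backNeighbours_le
        fun _ _ => PairColouring.mem_backNeighbours_of_adj)
    exact PairColouring.twelve_le_of_pair_colouring hc hproper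
end
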